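/- arXiv:2402.06576 — 6 statements merged into one kernel-verified Lean document; each statement's English description precedes it below -/
import Mathlib

section
/- If the value functions are monotone (for every seller s, f_s(w^s_i) is non-decreasing in i, and for every buyer b, f_b(w^b_j) is non-increasing in j), then there exists a valid trading assignment whose welfare equals the maximum weight of a matching in the resources–needs graph G'; consequently the maximum welfare over all valid trading assignments equals the maximum weight of a matching in G'. -/
open Finset

section Market

variable {S B : Type} [Fintype S] [Fintype B] [DecidableEq S] [DecidableEq B]

/-- The type of seller water units: unit `i` of seller `s` (0-indexed). -/
abbrev SUnit {S : Type} (gS : S → ℕ) : Type := Σ s : S, Fin (gS s)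

/-- The type of buyer water units: unit `j` of buyer `b` (0-indexed). -/
abbrev BUnit {B : Type} (gB : B → ℕ) : Type := Σ b : B, Fin (gB b)

/-- A trading assignment: a finite set of (seller unit, buyer unit) pairs such that
every pair is compatible and every water unit occurs in at most one pair. -/
def IsAssignment (gS : S → ℕ) (gB : B → ℕ) (E : S → B → Prop)
    (T : Finset (SUnit gS × BUnit gB)) : Prop :=
  (∀ p ∈ T, E p.1.1 p.2.1) ∧
  (∀ p ∈ T, ∀ q ∈ T, p.1 = q.1 → p = q) ∧
  (∀ p ∈ T, ∀ q ∈ T, p.2 = q.2 → p = q)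

/-- The value condition: the buyer values each traded unit at least as much as the seller. -/
def ValueCond (gS : S → ℕ) (gB : B → ℕ)
    (fS : ∀ s : S, Fin (gS s) → ℝ) (fB : ∀ b : B, Fin (gB b) → ℝ)
    (T : Finset (SUnit gS × BUnit gB)) : Prop :=
  ∀ p ∈ T, fS p.1.1 p.1.2 ≤ fB p.2.1 p.2.2

/-- The index `i - 1` (the preceding unit of the same agent). -/
def predIdx {n : ℕ} (j : Fin n) : Fin n :=
  ⟨(j : ℕ) - 1, lt_of_le_of_lt (Nat.sub_le _ _) j.isLt⟩

/-- A seller unit occurs in some pair of `T`. -/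
def SellerMatched (gS : S → ℕ) (gB : B → ℕ)
    (T : Finset (SUnit gS × BUnit gB)) (u : SUnit gS) : Prop :=
  ∃ p ∈ T, p.1 = u

/-- A buyer unit occurs in some pair of `T`. -/
def BuyerMatched (gS : S → ℕ) (gB : B → ℕ)
    (T : Finset (SUnit gS × BUnit gB)) (v : BUnit gB) : Prop :=
  ∃ p ∈ T, p.2 = v

/-- The priority condition: a unit of an agent is matched only if the preceding
unit of the same agent is matched. -/
def PriorityCond (gS : S → ℕ) (gB : B → ℕ)
    (T : Finset (SUnit gS × BUnit gB)) : Prop :=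
  (∀ s : S, ∀ i : Fin (gS s), (i : ℕ) ≠ 0 →
    SellerMatched gS gB T ⟨s, i⟩ → SellerMatched gS gB T ⟨s, predIdx i⟩) ∧
  (∀ b : B, ∀ j : Fin (gB b), (j : ℕ) ≠ 0 →
    BuyerMatched gS gB T ⟨b, j⟩ → BuyerMatched gS gB T ⟨b, predIdx j⟩)

/-- The welfare of a trading assignment. -/
def welfare (gS : S → ℕ) (gB : B → ℕ)
    (fS : ∀ s : S, Fin (gS s) → ℝ) (fB : ∀ b : B, Fin (gB b) → ℝ)
    (T : Finset (SUnit gS × BUnit gB)) : ℝ :=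
  ∑ p ∈ T, (fB p.2.1 p.2.2 - fS p.1.1 p.1.2)

/-- Edges of the resources--needs graph `G'`. -/
def IsEdge (gS : S → ℕ) (gB : B → ℕ)
    (fS : ∀ s : S, Fin (gS s) → ℝ) (fB : ∀ b : B, Fin (gB b) → ℝ)
    (E : S → B → Prop) (p : SUnit gS × BUnit gB) : Prop :=
  E p.1.1 p.2.1 ∧ fS p.1.1 p.1.2 ≤ fB p.2.1 p.2.2

/-- A matching of the resources--needs graph `G'`. -/
def IsMatching (gS : S → ℕ) (gB : B → ℕ)
    (fS : ∀ s : S, Fin (gS s) → ℝ) (fB : ∀ b : B, Fin (gB b) → ℝ)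
    (E : S → B → Prop) (M : Finset (SUnit gS × BUnit gB)) : Prop :=
  (∀ p ∈ M, IsEdge gS gB fS fB E p) ∧
  (∀ p ∈ M, ∀ q ∈ M, p.1 = q.1 → p = q) ∧
  (∀ p ∈ M, ∀ q ∈ M, p.2 = q.2 → p = q)

/-- The total weight of a matching of `G'`. -/
def matchWeight (gS : S → ℕ) (gB : B → ℕ)
    (fS : ∀ s : S, Fin (gS s) → ℝ) (fB : ∀ b : B, Fin (gB b) → ℝ)
    (M : Finset (SUnit gS × BUnit gB)) : ℝ :=
  ∑ p ∈ M, (fB p.2.1 p.2.2 - fS p.1.1 p.1.2)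

omit [Fintype S] [Fintype B] in
/-- Exchanging a pair of a finite set for a new one changes a sum by the difference of values. -/
lemma sum_insert_erase_add {A : Type*} [AddCommMonoid A] {gS : S → ℕ} {gB : B → ℕ}
    {M : Finset (SUnit gS × BUnit gB)} {p q : SUnit gS × BUnit gB} (hp : p ∈ M) (hq : q ∉ M)
    (g : SUnit gS × BUnit gB → A) :
    ∑ x ∈ insert q (M.erase p), g x + g p = ∑ x ∈ M, g x + g q := by
  rw [sum_insert (fun h => hq (mem_of_mem_erase h)), add_assoc, sum_erase_add _ _ hp, add_comm]

omit [Fintype S] [Fintype B] in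
/-- Exchanging a pair of a matching for an edge whose endpoints are not used by the remaining
pairs gives a matching. -/
lemma IsMatching.insert_erase {gS : S → ℕ} {gB : B → ℕ}
    {fS : ∀ s : S, Fin (gS s) → ℝ} {fB : ∀ b : B, Fin (gB b) → ℝ} {E : S → B → Prop}
    {M : Finset (SUnit gS × BUnit gB)} (hM : IsMatching gS gB fS fB E M)
    {p q : SUnit gS × BUnit gB} (hq : IsEdge gS gB fS fB E q)
    (hq₁ : ∀ x ∈ M, x ≠ p → x.1 ≠ q.1) (hq₂ : ∀ x ∈ M, x ≠ p → x.2 ≠ q.2) :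
    IsMatching gS gB fS fB E (insert q (M.erase p)) := by
  obtain ⟨hE, h₁, h₂⟩ := hM
  refine ⟨?_, ?_, ?_⟩
  · intro x hx
    rcases mem_insert.1 hx with rfl | hx
    · exact hq
    · exact hE x (mem_of_mem_erase hx)
  · intro x hx y hy hxy
    simp only [mem_insert, mem_erase] at hx hy
    rcases hx with rfl | ⟨hxp, hx⟩ <;> rcases hy with rfl | ⟨hyp, hy⟩
    · rfl
    · exact absurd hxy.symm (hq₁ y hy hyp)
    · exact absurd hxy (hq₁ x hx hxp)
    · exact h₁ x hx y hy hxy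
  · intro x hx y hy hxy
    simp only [mem_insert, mem_erase] at hx hy
    rcases hx with rfl | ⟨hxp, hx⟩ <;> rcases hy with rfl | ⟨hyp, hy⟩
    · rfl
    · exact absurd hxy.symm (hq₂ y hy hyp)
    · exact absurd hxy (hq₂ x hx hxp)
    · exact h₂ x hx y hy hxy

/-- The sum of the indices of all units traded in `M`. -/
def indexSum {gS : S → ℕ} {gB : B → ℕ} (M : Finset (SUnit gS × BUnit gB)) : ℕ :=
  ∑ p ∈ M, ((p.1.2 : ℕ) + (p.2.2 : ℕ))

lemma predIdx_le {n : ℕ} (j : Fin n) : predIdx j ≤ j :=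
  Fin.le_def.2 (Nat.sub_le _ _)

lemma predIdx_lt {n : ℕ} {j : Fin n} (hj : (j : ℕ) ≠ 0) : (predIdx j : ℕ) < j :=
  Nat.sub_lt (Nat.pos_of_ne_zero hj) one_pos

omit [Fintype S] [Fintype B] in
/-- A maximum-weight matching with the least index sum satisfies the priority condition. -/
lemma IsMatching.priorityCond_of_minimal {gS : S → ℕ} {gB : B → ℕ}
    {fS : ∀ s : S, Fin (gS s) → ℝ} {fB : ∀ b : B, Fin (gB b) → ℝ} {E : S → B → Prop}
    (hfS : ∀ s : S, Monotone (fS s)) (hfB : ∀ b : B, Antitone (fB b))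
    {M : Finset (SUnit gS × BUnit gB)} (hM : IsMatching gS gB fS fB E M)
    (hmin : ∀ M', IsMatching gS gB fS fB E M' →
      matchWeight gS gB fS fB M ≤ matchWeight gS gB fS fB M' → indexSum M ≤ indexSum M') :
    PriorityCond gS gB M := by
  refine ⟨?_, ?_⟩
  · rintro s i hi ⟨⟨_, v⟩, hp, rfl⟩
    by_contra hun
    have hun' : ∀ x ∈ M, x.1 ≠ ⟨s, predIdx i⟩ := fun x hx h => hun ⟨x, hx, h⟩
    have hval := hfS s (predIdx_le i)
    have hlt := predIdx_lt hi
    have hE := hM.1 _ hp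
    have hq : ((⟨s, predIdx i⟩, v) : SUnit gS × BUnit gB) ∉ M := fun h => hun' _ h rfl
    have hM' := hM.insert_erase (p := (⟨s, i⟩, v)) (q := (⟨s, predIdx i⟩, v))
      ⟨hE.1, hval.trans hE.2⟩ (fun x hx _ => hun' x hx)
      (fun x hx hne h => hne (hM.2.2 x hx _ hp h))
    have hw := sum_insert_erase_add hp hq fun x => fB x.2.1 x.2.2 - fS x.1.1 x.1.2
    have hn := sum_insert_erase_add hp hq fun x => (x.1.2 : ℕ) + (x.2.2 : ℕ)
    have := hmin _ hM' (by unfold matchWeight; dsimp only at hw; linarith)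
    unfold indexSum at this
    dsimp only at hn
    omega
  · rintro b j hj ⟨⟨u, _⟩, hp, rfl⟩
    by_contra hun
    have hun' : ∀ x ∈ M, x.2 ≠ ⟨b, predIdx j⟩ := fun x hx h => hun ⟨x, hx, h⟩
    have hval := hfB b (predIdx_le j)
    have hlt := predIdx_lt hj
    have hE := hM.1 _ hp
    have hq : ((u, ⟨b, predIdx j⟩) : SUnit gS × BUnit gB) ∉ M := fun h => hun' _ h rfl
    have hM' := hM.insert_erase (p := (u, ⟨b, j⟩)) (q := (u, ⟨b, predIdx j⟩))
      ⟨hE.1, hE.2.trans hval⟩ (fun x hx hne h => hne (hM.2.1 x hx _ hp h))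
      (fun x hx _ => hun' x hx)
    have hw := sum_insert_erase_add hp hq fun x => fB x.2.1 x.2.2 - fS x.1.1 x.1.2
    have hn := sum_insert_erase_add hp hq fun x => (x.1.2 : ℕ) + (x.2.2 : ℕ)
    have := hmin _ hM' (by unfold matchWeight; dsimp only at hw; linarith)
    unfold indexSum at this
    dsimp only at hn
    omega

/-- with monotone value functions (seller values non-decreasing, buyer values
non-increasing in the unit index), there is a valid trading assignment whose welfare equals
the maximum weight of a matching in `G'`; consequently the maximum welfare over valid
trading assignments equals the maximum matching weight. -/
theorem maxWelfare_eq_maxMatchingWeight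
    (gS : S → ℕ) (gB : B → ℕ)
    (fS : ∀ s : S, Fin (gS s) → ℝ) (fB : ∀ b : B, Fin (gB b) → ℝ)
    (E : S → B → Prop)
    (hfS : ∀ s : S, Monotone (fS s))
    (hfB : ∀ b : B, Antitone (fB b))
    (Mmax : Finset (SUnit gS × BUnit gB))
    (hM : IsMatching gS gB fS fB E Mmax)
    (hmax : ∀ M', IsMatching gS gB fS fB E M' →
      matchWeight gS gB fS fB M' ≤ matchWeight gS gB fS fB Mmax) :
    (∃ T : Finset (SUnit gS × BUnit gB),
      IsAssignment gS gB E T ∧ ValueCond gS gB fS fB T ∧ PriorityCond gS gB T ∧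
      welfare gS gB fS fB T = matchWeight gS gB fS fB Mmax) ∧
    (∀ T : Finset (SUnit gS × BUnit gB),
      IsAssignment gS gB E T → ValueCond gS gB fS fB T → PriorityCond gS gB T →
      welfare gS gB fS fB T ≤ matchWeight gS gB fS fB Mmax) := by
  refine ⟨?_, fun T hT hv _ => hmax T ⟨fun p hp => ⟨hT.1 p hp, hv p hp⟩, hT.2⟩⟩
  obtain ⟨M, ⟨hMm, hMw⟩, hmin⟩ := (measure (indexSum (gS := gS) (gB := gB))).wf.has_min
    {M | IsMatching gS gB fS fB E M ∧
      matchWeight gS gB fS fB M = matchWeight gS gB fS fB Mmax} ⟨Mmax, hM, rfl⟩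
  exact ⟨M, ⟨fun p hp => (hMm.1 p hp).1, hMm.2⟩, fun p hp => (hMm.1 p hp).2,
    hMm.priorityCond_of_minimal hfS hfB fun M' hM' hle =>
      not_lt.1 (hmin M' ⟨hM', (hmax M' hM').antisymm (hMw ▸ hle)⟩), hMw⟩

end Market
end

section
/- Let T be a trading assignment satisfying the value condition, let b ∈ B be a buyer whose value function f_b is non-increasing in the unit index, and suppose (w^s_i, w^b_j) ∈ T for some j > 1 while the unit w^b_{j−1} occurs in no pair of T. Then T' = (T \ {(w^s_i, w^b_j)}) ∪ {(w^s_i, w^b_{j−1})} is a trading assignment satisfying the value condition, and welfare(T') ≥ welfare(T). -/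
open Finset

section Market

variable {S B : Type} [Fintype S] [Fintype B] [DecidableEq S] [DecidableEq B]

/-- replacing a matched buyer unit by the preceding (unmatched) unit of the
same buyer, whose value function is non-increasing, preserves the assignment and value
conditions and does not decrease welfare. -/
theorem buyer_unit_swap
    (gS : S → ℕ) (gB : B → ℕ)
    (fS : ∀ s : S, Fin (gS s) → ℝ) (fB : ∀ b : B, Fin (gB b) → ℝ)
    (E : S → B → Prop)
    (T : Finset (SUnit gS × BUnit gB))
    (hT : IsAssignment gS gB E T)
    (hval : ValueCond gS gB fS fB T)
    (b : B) (hmono : Antitone (fB b))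
    (u : SUnit gS) (j : Fin (gB b)) (hj : (j : ℕ) ≠ 0)
    (hmem : (u, (⟨b, j⟩ : BUnit gB)) ∈ T)
    (hun : ¬ BuyerMatched gS gB T ⟨b, predIdx j⟩) :
    IsAssignment gS gB E
      (insert (u, (⟨b, predIdx j⟩ : BUnit gB)) (T.erase (u, ⟨b, j⟩))) ∧
    ValueCond gS gB fS fB
      (insert (u, (⟨b, predIdx j⟩ : BUnit gB)) (T.erase (u, ⟨b, j⟩))) ∧
    welfare gS gB fS fB T ≤
      welfare gS gB fS fB
        (insert (u, (⟨b, predIdx j⟩ : BUnit gB)) (T.erase (u, ⟨b, j⟩))) := by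
  obtain ⟨hE, hS, hB⟩ := hT
  have hle : predIdx j ≤ j := Fin.le_def.2 (Nat.sub_le _ _)
  have hfresh : ∀ q ∈ T, q.2 ≠ ⟨b, predIdx j⟩ := fun q hq h => hun ⟨q, hq, h⟩
  have hseller : ∀ q ∈ T.erase (u, ⟨b, j⟩), q.1 ≠ u := fun q hq h =>
    ne_of_mem_erase hq (hS q (mem_of_mem_erase hq) _ hmem h)
  refine ⟨⟨?_, ?_, ?_⟩, ?_, ?_⟩
  · intro p hp
    rcases mem_insert.1 hp with rfl | hp
    · exact hE (u, ⟨b, j⟩) hmem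
    · exact hE p (mem_of_mem_erase hp)
  · intro p hp q hq h
    rcases mem_insert.1 hp with rfl | hp <;> rcases mem_insert.1 hq with rfl | hq
    · rfl
    · exact absurd h.symm (hseller q hq)
    · exact absurd h (hseller p hp)
    · exact hS p (mem_of_mem_erase hp) q (mem_of_mem_erase hq) h
  · intro p hp q hq h
    rcases mem_insert.1 hp with rfl | hp <;> rcases mem_insert.1 hq with rfl | hq
    · rfl
    · exact absurd h.symm (hfresh q (mem_of_mem_erase hq))
    · exact absurd h (hfresh p (mem_of_mem_erase hp))
    · exact hB p (mem_of_mem_erase hp) q (mem_of_mem_erase hq) h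
  · intro p hp
    rcases mem_insert.1 hp with rfl | hp
    · exact (hval _ hmem).trans (hmono hle)
    · exact hval p (mem_of_mem_erase hp)
  · have hnotMem : (u, (⟨b, predIdx j⟩ : BUnit gB)) ∉ T.erase (u, ⟨b, j⟩) :=
      fun h => hseller _ h rfl
    unfold welfare
    rw [sum_insert hnotMem, ← add_sum_erase T _ hmem]
    gcongr
    exact hmono hle

end Market
end

section
/- Let T be a trading assignment satisfying the value condition, let s ∈ S be a seller whose value function f_s is non-decreasing in the unit index, and suppose (w^s_i, w^b_j) ∈ T for some i > 1 while the unit w^s_{i−1} occurs in no pair of T. Then T' = (T \ {(w^s_i, w^b_j)}) ∪ {(w^s_{i−1}, w^b_j)} is a trading assignment satisfying the value condition, and welfare(T') ≥ welfare(T). -/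
open Finset

section Market

variable {S B : Type} [Fintype S] [Fintype B] [DecidableEq S] [DecidableEq B]

/-- replacing a matched seller unit by the preceding (unmatched) unit of the
same seller, whose value function is non-decreasing, preserves the assignment and value
conditions and does not decrease welfare. -/
theorem seller_unit_swap
    (gS : S → ℕ) (gB : B → ℕ)
    (fS : ∀ s : S, Fin (gS s) → ℝ) (fB : ∀ b : B, Fin (gB b) → ℝ)
    (E : S → B → Prop)
    (T : Finset (SUnit gS × BUnit gB))
    (hT : IsAssignment gS gB E T)
    (hval : ValueCond gS gB fS fB T)
    (s : S) (hmono : Monotone (fS s))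
    (i : Fin (gS s)) (hi : (i : ℕ) ≠ 0) (v : BUnit gB)
    (hmem : ((⟨s, i⟩ : SUnit gS), v) ∈ T)
    (hun : ¬ SellerMatched gS gB T ⟨s, predIdx i⟩) :
    IsAssignment gS gB E
      (insert ((⟨s, predIdx i⟩ : SUnit gS), v) (T.erase (⟨s, i⟩, v))) ∧
    ValueCond gS gB fS fB
      (insert ((⟨s, predIdx i⟩ : SUnit gS), v) (T.erase (⟨s, i⟩, v))) ∧
    welfare gS gB fS fB T ≤
      welfare gS gB fS fB
        (insert ((⟨s, predIdx i⟩ : SUnit gS), v) (T.erase (⟨s, i⟩, v))) := by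
  have hle : fS s (predIdx i) ≤ fS s i := hmono (Nat.sub_le _ _)
  have hnew : ∀ p ∈ T, p.1 ≠ ⟨s, predIdx i⟩ := fun p hp h => hun ⟨p, hp, h⟩
  have hbuyer : ∀ p ∈ T, p ≠ (⟨s, i⟩, v) → p.2 ≠ v :=
    fun p hp hne h => hne (hT.2.2 p hp _ hmem h)
  refine ⟨⟨?_, ?_, ?_⟩, ?_, ?_⟩
  · simp only [mem_insert, mem_erase]
    rintro p (rfl | ⟨-, hp⟩)
    · exact hT.1 (⟨s, i⟩, v) hmem
    · exact hT.1 p hp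
  · simp only [mem_insert, mem_erase]
    rintro p (rfl | ⟨-, hp⟩) q (rfl | ⟨-, hq⟩) h
    · rfl
    · exact (hnew q hq h.symm).elim
    · exact (hnew p hp h).elim
    · exact hT.2.1 p hp q hq h
  · simp only [mem_insert, mem_erase]
    rintro p (rfl | ⟨hpne, hp⟩) q (rfl | ⟨hqne, hq⟩) h
    · rfl
    · exact (hbuyer q hq hqne h.symm).elim
    · exact (hbuyer p hp hpne h).elim
    · exact hT.2.2 p hp q hq h
  · simp only [ValueCond, mem_insert, mem_erase]
    rintro p (rfl | ⟨-, hp⟩)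
    · exact hle.trans (hval _ hmem)
    · exact hval p hp
  · have hnotin : ((⟨s, predIdx i⟩ : SUnit gS), v) ∉ T.erase (⟨s, i⟩, v) :=
      fun h => hnew _ (mem_of_mem_erase h) rfl
    rw [welfare, welfare, sum_insert hnotin, ← add_sum_erase T _ hmem]
    gcongr

end Market
end

section
/- Let G(V,E) be a finite undirected graph and k ≤ |V| a positive integer. Consider the feasibility instance with k sellers each owning a single water unit, buyer set B = V, the complete resources–needs compatibility graph (any seller unit may be assigned to any buyer), and, for each edge {v_x, v_y} ∈ E, the constraint that buyers v_x and v_y together receive at least one water unit. Then this instance admits a feasible trading assignment (a matching of seller units to buyers satisfying all edge constraints) if and only if G has a vertex cover of size at most k. -/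
open Finset

/-- the feasibility instance derived from a graph `G` and an integer
`k ≤ |V|` — with `k` sellers each owning one water unit, buyer set `V`, complete
compatibility, and the constraint that the endpoints of each edge jointly receive at
least one unit — admits a feasible trading assignment iff `G` has a vertex cover of
size at most `k`. A trading assignment is modelled as a function sending each of the
`k` seller units to at most one buyer. -/
theorem feasibility_iff_vertexCover {V : Type} [Fintype V] [DecidableEq V]
    (G : SimpleGraph V) (k : ℕ) (hk : 0 < k) (hkV : k ≤ Fintype.card V) :
    (∃ f : Fin k → Option V,
      ∀ x y : V, G.Adj x y → ∃ i : Fin k, f i = some x ∨ f i = some y) ↔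
    (∃ V' : Finset V, V'.card ≤ k ∧
      ∀ x y : V, G.Adj x y → x ∈ V' ∨ y ∈ V') := by
  constructor
  · rintro ⟨f, hf⟩
    refine ⟨eraseNone (univ.image f), ?_, fun x y hxy => ?_⟩
    · calc (eraseNone (univ.image f)).card ≤ (univ.image f).card := card_eraseNone_le _
        _ ≤ (univ : Finset (Fin k)).card := card_image_le
        _ = k := by simp
    · obtain ⟨i, hi | hi⟩ := hf x y hxy
      · exact Or.inl (by simpa using ⟨i, hi⟩)
      · exact Or.inr (by simpa using ⟨i, hi⟩)
  · rintro ⟨V', hcard, hcover⟩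
    let f : Fin k → Option V := fun i =>
      if h : (i : ℕ) < V'.card then some (V'.equivFin.symm ⟨i, h⟩ : V) else none
    have hf : ∀ v ∈ V', ∃ i, f i = some v := fun v hv =>
      ⟨Fin.castLE hcard (V'.equivFin ⟨v, hv⟩), by simp [f]⟩
    refine ⟨f, fun x y hxy => ?_⟩
    rcases hcover x y hxy with hx | hy
    · exact (hf x hx).imp fun _ => Or.inl
    · exact (hf y hy).imp fun _ => Or.inr
end

section
/- For every buyer b_j and every ℓ with 1 ≤ ℓ ≤ ρ_j − 1, the incremental benefits satisfy δ_j(ℓ)/δ_j(ℓ+1) ≥ |B|·k > 1; hence δ_j is monotone decreasing in ℓ, and the benefit function μ_j satisfies the diminishing returns property: μ_j(ℓ) − μ_j(ℓ−1) ≤ μ_j(ℓ−1) − μ_j(ℓ−2) for 2 ≤ ℓ ≤ ρ_j. -/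
open Finset

section Leximin

/-- The finite set `F = {p/q : p, q ∈ {1, …, k}, p ≤ q} ∪ {0}` of possible
satisfaction ratios. -/
def Fset (k : ℕ) : Finset ℚ :=
  insert 0
    ((((Finset.Icc 1 k) ×ˢ (Finset.Icc 1 k)).filter fun pq => pq.1 ≤ pq.2).image
      fun pq => (pq.1 : ℚ) / (pq.2 : ℚ))

/-- The rank `π(q)` of `q` in `F` sorted in descending order (the rank of the largest
element is 1): the number of elements of `F` that are `≥ q`. -/
def rankDesc (k : ℕ) (q : ℚ) : ℕ := ((Fset k).filter fun x => q ≤ x).card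

/-- `ξ(q) = N ^ π(q) / N ^ |F|`, where `N = |B| · k`. -/
noncomputable def xi (N k : ℕ) (q : ℚ) : ℝ :=
  (N : ℝ) ^ rankDesc k q / (N : ℝ) ^ (Fset k).card

variable {B : Type} [Fintype B]

/-- The incremental benefit `δ_j(ℓ) = ξ((ℓ - 1) / ρ_j)` of buyer `j` for
its `ℓ`-th assigned water unit. -/
noncomputable def delta (k : ℕ) (ρ : B → ℕ) (j : B) (l : ℕ) : ℝ :=
  xi (Fintype.card B * k) k (((l : ℚ) - 1) / (ρ j : ℚ))

/-- The benefit function `μ_j(ℓ) = Σ_{ℓ'=1}^{ℓ} δ_j(ℓ')` (so `μ_j(0) = 0`). -/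
noncomputable def mu (k : ℕ) (ρ : B → ℕ) (j : B) (l : ℕ) : ℝ :=
  ∑ l' ∈ Finset.Icc 1 l, delta k ρ j l'

theorem natCast_div_mem_Fset {k m r : ℕ} (hmr : m < r) (hrk : r ≤ k) :
    (m : ℚ) / (r : ℚ) ∈ Fset k := by
  rcases Nat.eq_zero_or_pos m with rfl | hm
  · simp [Fset]
  · refine mem_insert_of_mem (mem_image.2 ⟨(m, r), ?_, rfl⟩)
    simp only [mem_filter, mem_product, mem_Icc]
    omega

theorem rankDesc_lt_rankDesc {k : ℕ} {q q' : ℚ} (hq : q ∈ Fset k) (h : q < q') :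
    rankDesc k q' < rankDesc k q := by
  refine card_lt_card (ssubset_iff_of_subset ?_ |>.2 ⟨q, by simp [hq], by simp [h]⟩)
  exact monotone_filter_right _ fun _ _ hx => h.le.trans hx

theorem xi_pos {N : ℕ} (hN : 0 < N) (k : ℕ) (q : ℚ) : 0 < xi N k q := by
  unfold xi
  positivity

theorem mul_xi_le_xi {N k : ℕ} (hN : 1 ≤ N) {q q' : ℚ} (hq : q ∈ Fset k) (h : q < q') :
    (N : ℝ) * xi N k q' ≤ xi N k q := by
  have hN' : (1 : ℝ) ≤ N := by exact_mod_cast hN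
  unfold xi
  rw [← mul_div_assoc, ← pow_succ']
  gcongr
  exact rankDesc_lt_rankDesc hq h

theorem mul_delta_le_delta {k : ℕ} {B : Type} [Fintype B] {ρ : B → ℕ} {j : B}
    (hρ : ρ j ≤ k) (hN : 1 ≤ Fintype.card B * k) {l l' : ℕ} (hl : 1 ≤ l) (hll' : l < l')
    (hl' : l' ≤ ρ j) :
    (Fintype.card B * k : ℝ) * delta k ρ j l' ≤ delta k ρ j l := by
  have hmem : ((l : ℚ) - 1) / (ρ j : ℚ) ∈ Fset k := by
    have := natCast_div_mem_Fset (m := l - 1) (by omega : l - 1 < ρ j) hρ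
    rwa [Nat.cast_sub hl, Nat.cast_one] at this
  have hpos : (0 : ℚ) < ρ j := by exact_mod_cast (by omega : 0 < ρ j)
  have hlt : ((l : ℚ) - 1) / (ρ j : ℚ) < ((l' : ℚ) - 1) / (ρ j : ℚ) := by
    gcongr
  have := mul_xi_le_xi hN hmem hlt
  rwa [Nat.cast_mul] at this

theorem mu_succ {B : Type} (k : ℕ) [Fintype B] (ρ : B → ℕ) (j : B) (l : ℕ) :
    mu k ρ j (l + 1) = mu k ρ j l + delta k ρ j (l + 1) :=
  sum_Icc_succ_top (by omega) _

/-- for each buyer `j` and `1 ≤ ℓ ≤ ρ_j − 1`, the ratio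
`δ_j(ℓ)/δ_j(ℓ+1)` is at least `|B|·k > 1`; hence `δ_j` is monotone decreasing and `μ_j`
has the diminishing returns property. -/
theorem delta_ratio_and_diminishing_returns
    (k : ℕ) {B : Type} [Fintype B] (ρ : B → ℕ)
    (hρ : ∀ j : B, 1 ≤ ρ j ∧ ρ j ≤ k)
    (hN : 2 ≤ Fintype.card B * k) :
    (∀ j : B, ∀ l : ℕ, 1 ≤ l → l + 1 ≤ ρ j →
      ((Fintype.card B * k : ℝ) ≤ delta k ρ j l / delta k ρ j (l + 1) ∧
        (1 : ℝ) < (Fintype.card B * k : ℝ))) ∧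
    (∀ j : B, ∀ l l' : ℕ, 1 ≤ l → l < l' → l' ≤ ρ j →
      delta k ρ j l' < delta k ρ j l) ∧
    (∀ j : B, ∀ l : ℕ, 2 ≤ l → l ≤ ρ j →
      mu k ρ j l - mu k ρ j (l - 1) ≤ mu k ρ j (l - 1) - mu k ρ j (l - 2)) := by
  have hN1 : (1 : ℝ) < (Fintype.card B * k : ℝ) := by
    exact_mod_cast (by omega : 1 < Fintype.card B * k)
  have hpos : ∀ j l, 0 < delta k ρ j l := fun j l => xi_pos (by omega) _ _
  have hlt : ∀ j : B, ∀ l l' : ℕ, 1 ≤ l → l < l' → l' ≤ ρ j →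
      delta k ρ j l' < delta k ρ j l := fun j l l' hl hll' hl' =>
    (lt_mul_of_one_lt_left (hpos j l') hN1).trans_le
      (mul_delta_le_delta (hρ j).2 (by omega) hl hll' hl')
  refine ⟨fun j l hl hl' => ⟨?_, hN1⟩, hlt, fun j l hl hl' => ?_⟩
  · rw [le_div_iff₀ (hpos j (l + 1))]
    exact mul_delta_le_delta (hρ j).2 (by omega) hl l.lt_succ_self hl'
  · obtain ⟨m, rfl⟩ := Nat.exists_eq_add_of_le' hl
    have h₁ := mu_succ k ρ j (m + 1)
    have h₂ := mu_succ k ρ j m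
    have h₃ := hlt j (m + 1) (m + 2) (by omega) (by omega) hl'
    simp only [Nat.add_sub_cancel, show m + 2 - 1 = m + 1 by omega] at *
    linarith

end Leximin
end

section
/- Assume the value functions are monotone (for every seller s, f_s(w^s_i) is non-decreasing in i, and for every buyer b, f_b(w^b_j) is non-increasing in j). Let z be any feasible solution of the linear program over variables z_{s_i b_j} ≥ 0 for edges {s_i, b_j} of the resources–needs graph G', with the matching constraints that the total z-value of edges incident to each seller unit is at most 1 and the total z-value of edges incident to each buyer unit is at most 1, and with lower-bound constraints requiring, for each set L in a given collection 𝓛 of subsets of B, that the total z-value over edges incident to units of buyers in L is at least r(L). Then there exists a feasible solution z' of the same linear program whose objective value Σ α_e z'_e is at least that of z and which satisfies the prefix property: for every buyer b and every j > 1, if z'_{s_i b_j} > 0 for some seller unit s_i, then the total z'-value of edges incident to the buyer unit b_{j−1} equals 1. -/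
open Finset

section Market

variable {S B : Type} [Fintype S] [Fintype B] [DecidableEq S] [DecidableEq B]

/-- Feasibility for the LP with matching constraints and, for each set `L` of buyers in
the collection `𝓛`, the lower-bound constraint that the total `z`-value over edges
incident to units of buyers in `L` is at least `r L`. Variables are supported on the
edges of `G'` and nonnegative. -/
def LPFeasibleL (gS : S → ℕ) (gB : B → ℕ)
    (fS : ∀ s : S, Fin (gS s) → ℝ) (fB : ∀ b : B, Fin (gB b) → ℝ)
    (E : S → B → Prop) (L : Finset (Finset B)) (r : Finset B → ℕ)
    (z : SUnit gS × BUnit gB → ℝ) : Prop :=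
  (∀ e, 0 ≤ z e) ∧
  (∀ e, ¬ IsEdge gS gB fS fB E e → z e = 0) ∧
  (∀ u : SUnit gS, ∑ v : BUnit gB, z (u, v) ≤ 1) ∧
  (∀ v : BUnit gB, ∑ u : SUnit gS, z (u, v) ≤ 1) ∧
  (∀ A ∈ L, (r A : ℝ) ≤ ∑ b ∈ A, ∑ j : Fin (gB b), ∑ u : SUnit gS, z (u, ⟨b, j⟩))

/-- The LP objective `Σ_e α_e z_e`. -/
def lpObj (gS : S → ℕ) (gB : B → ℕ)
    (fS : ∀ s : S, Fin (gS s) → ℝ) (fB : ∀ b : B, Fin (gB b) → ℝ)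
    (z : SUnit gS × BUnit gB → ℝ) : ℝ :=
  ∑ e : SUnit gS × BUnit gB, (fB e.2.1 e.2.2 - fS e.1.1 e.1.2) * z e

/-- Move an amount `ε` of `w` along two edges at the same left node `u`: from the edge to `v` to
the edge to the second given right node. -/
def shiftMass {α β : Type} [DecidableEq α] [DecidableEq β] (w : α × β → ℝ) (u : α) (v v' : β)
    (ε : ℝ) : α × β → ℝ :=
  fun e => w e + ε * ((if e = (u, v') then 1 else 0) - (if e = (u, v) then 1 else 0))

section ShiftMass

variable {α β : Type} [DecidableEq α] [DecidableEq β]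

theorem sum_mul_shiftMass [Fintype α] [Fintype β] (c w : α × β → ℝ) (u : α) (v v' : β) (ε : ℝ) :
    ∑ e, c e * shiftMass w u v v' ε e = ∑ e, c e * w e + ε * (c (u, v') - c (u, v)) := by
  have h : ∀ e, c e * shiftMass w u v v' ε e = c e * w e +
      ε * ((if e = (u, v') then c e else 0) - (if e = (u, v) then c e else 0)) := by
    intro e
    unfold shiftMass
    split_ifs <;> ring
  simp only [h, Finset.sum_add_distrib, ← Finset.mul_sum, Finset.sum_sub_distrib,
    Finset.sum_ite_eq', Finset.mem_univ, if_true]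

theorem sum_right_shiftMass [Fintype β] (w : α × β → ℝ) (u : α) (v v' : β) (ε : ℝ) (a : α) :
    ∑ x, shiftMass w u v v' ε (a, x) = ∑ x, w (a, x) := by
  simp only [shiftMass, Finset.sum_add_distrib, ← Finset.mul_sum, Finset.sum_sub_distrib,
    Prod.mk.injEq]
  by_cases ha : a = u <;> simp [ha]

theorem sum_left_shiftMass [Fintype α] (w : α × β → ℝ) (u : α) (v v' : β) (ε : ℝ) (x : β) :
    ∑ a, shiftMass w u v v' ε (a, x) =
      ∑ a, w (a, x) + ε * ((if x = v' then 1 else 0) - (if x = v then 1 else 0)) := by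
  simp only [shiftMass, Finset.sum_add_distrib, ← Finset.mul_sum, Finset.sum_sub_distrib,
    Prod.mk.injEq, ite_and, Finset.sum_ite_eq', Finset.mem_univ, if_true]

end ShiftMass

omit [Fintype B] in
theorem sum_ite_sigma_mk_eq (gB : B → ℕ) (b b₀ : B) (k : Fin (gB b)) :
    (∑ j : Fin (gB b₀), if (⟨b₀, j⟩ : BUnit gB) = ⟨b, k⟩ then (1 : ℝ) else 0) =
      if b₀ = b then 1 else 0 := by
  by_cases h : b₀ = b
  · subst h
    simp
  · simp [h]

/-- Shifting mass from a unit of a buyer to another unit of the same buyer that it values at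
least as much preserves feasibility. -/
theorem LPFeasibleL.shiftMass {gS : S → ℕ} {gB : B → ℕ}
    {fS : ∀ s : S, Fin (gS s) → ℝ} {fB : ∀ b : B, Fin (gB b) → ℝ} {E : S → B → Prop}
    {L : Finset (Finset B)} {r : Finset B → ℕ} {w : SUnit gS × BUnit gB → ℝ}
    (hw : LPFeasibleL gS gB fS fB E L r w) {u : SUnit gS} {b : B} {j k : Fin (gB b)}
    (hjk : fB b j ≤ fB b k) {ε : ℝ} (hε : 0 < ε) (hεw : ε ≤ w (u, ⟨b, j⟩))
    (hεk : ∑ a, w (a, ⟨b, k⟩) + ε ≤ 1) :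
    LPFeasibleL gS gB fS fB E L r (shiftMass w u ⟨b, j⟩ ⟨b, k⟩ ε) := by
  obtain ⟨h0, hE, hS, hB, hL⟩ := hw
  have hedge : IsEdge gS gB fS fB E (u, ⟨b, j⟩) := by
    by_contra h
    linarith [hE _ h]
  refine ⟨fun e => ?_, fun e he => ?_, fun a => ?_, fun x => ?_, fun A hA => ?_⟩
  · have := h0 e
    unfold _root_.shiftMass
    split_ifs with h₁ h₂ h₂
    · linarith
    · linarith
    · subst h₂
      linarith
    · linarith
  · have h₁ : e ≠ (u, ⟨b, k⟩) := by
      rintro rfl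
      exact he ⟨hedge.1, hedge.2.trans hjk⟩
    have h₂ : e ≠ (u, ⟨b, j⟩) := by
      rintro rfl
      exact he hedge
    simp [_root_.shiftMass, h₁, h₂, hE e he]
  · rw [sum_right_shiftMass]
    exact hS a
  · rw [sum_left_shiftMass]
    have := hB x
    split_ifs with h₁ h₂ h₂
    · linarith
    · subst h₁
      linarith
    · linarith
    · linarith
  · refine (hL A hA).trans_eq (Finset.sum_congr rfl fun b₀ _ => ?_)
    simp only [sum_left_shiftMass, Finset.sum_add_distrib, ← Finset.mul_sum,
      Finset.sum_sub_distrib, sum_ite_sigma_mk_eq, sub_self, mul_zero, add_zero]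

omit [DecidableEq S] [DecidableEq B] in
theorem isCompact_setOf_lpFeasibleL (gS : S → ℕ) (gB : B → ℕ)
    (fS : ∀ s : S, Fin (gS s) → ℝ) (fB : ∀ b : B, Fin (gB b) → ℝ) (E : S → B → Prop)
    (L : Finset (Finset B)) (r : Finset B → ℕ) :
    IsCompact {w | LPFeasibleL gS gB fS fB E L r w} := by
  refine (isCompact_Icc (a := (0 : SUnit gS × BUnit gB → ℝ)) (b := 1)).of_isClosed_subset ?_ ?_
  · simp only [LPFeasibleL, Set.ofPred_and, Set.ofPred_forall]
    refine IsClosed.inter ?_ (IsClosed.inter ?_ (IsClosed.inter ?_ (IsClosed.inter ?_ ?_)))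
    · exact isClosed_iInter fun e => isClosed_le (by fun_prop) (by fun_prop)
    · exact isClosed_iInter fun e => isClosed_iInter fun _ =>
        isClosed_eq (by fun_prop) (by fun_prop)
    · exact isClosed_iInter fun e => isClosed_le (by fun_prop) (by fun_prop)
    · exact isClosed_iInter fun e => isClosed_le (by fun_prop) (by fun_prop)
    · exact isClosed_iInter fun e => isClosed_iInter fun _ =>
        isClosed_le (by fun_prop) (by fun_prop)
  · rintro w ⟨h0, -, hS, -, -⟩
    exact ⟨h0, fun e => (Finset.single_le_sum (f := fun v => w (e.1, v)) (fun v _ => h0 _)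
      (Finset.mem_univ e.2)).trans (hS e.1)⟩

/-- with monotone value functions, any feasible LP solution can be
transformed into one with at least the same objective value satisfying the prefix
property: whenever some edge at buyer unit `b_j` (with `j > 1`) carries positive
`z`-value, the total `z`-value at the preceding buyer unit `b_{j-1}` equals 1. -/
theorem lp_prefix_property
    (gS : S → ℕ) (gB : B → ℕ)
    (fS : ∀ s : S, Fin (gS s) → ℝ) (fB : ∀ b : B, Fin (gB b) → ℝ)
    (E : S → B → Prop)
    (hfS : ∀ s : S, Monotone (fS s))
    (hfB : ∀ b : B, Antitone (fB b))
    (L : Finset (Finset B)) (r : Finset B → ℕ)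
    (hr : ∀ A ∈ L, 1 ≤ r A)
    (z : SUnit gS × BUnit gB → ℝ)
    (hz : LPFeasibleL gS gB fS fB E L r z) :
    ∃ z' : SUnit gS × BUnit gB → ℝ,
      LPFeasibleL gS gB fS fB E L r z' ∧
      lpObj gS gB fS fB z ≤ lpObj gS gB fS fB z' ∧
      (∀ b : B, ∀ j : Fin (gB b), (j : ℕ) ≠ 0 →
        (∃ u : SUnit gS, 0 < z' (u, ⟨b, j⟩)) →
        ∑ u : SUnit gS, z' (u, ⟨b, predIdx j⟩) = 1) := by
  have hcont : ∀ c : SUnit gS × BUnit gB → ℝ,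
      Continuous fun w : SUnit gS × BUnit gB → ℝ => ∑ e, c e * w e := fun c => by fun_prop
  have hK : IsCompact ({w | LPFeasibleL gS gB fS fB E L r w} ∩
      {w | lpObj gS gB fS fB z ≤ lpObj gS gB fS fB w}) :=
    (isCompact_setOf_lpFeasibleL gS gB fS fB E L r).inter_right
      (isClosed_le continuous_const (hcont _))
  obtain ⟨w, ⟨hw, hobj⟩, hmin⟩ := hK.exists_isMinOn ⟨z, hz, le_refl (lpObj gS gB fS fB z)⟩
    (hcont fun e => ((e.2.2 : ℕ) : ℝ)).continuousOn
  refine ⟨w, hw, hobj, fun b j hj ⟨u, hu⟩ => ?_⟩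
  by_contra hne
  have hlt := lt_of_le_of_ne (hw.2.2.2.1 ⟨b, predIdx j⟩) hne
  have hfB' : fB b j ≤ fB b (predIdx j) := hfB b (Fin.le_def.2 (Nat.sub_le _ _))
  obtain ⟨ε, hε, hε'⟩ := exists_between (lt_min hu (sub_pos.2 hlt))
  have hεw := (lt_min_iff.1 hε').1
  have hεk := (lt_min_iff.1 hε').2
  have hfeas := hw.shiftMass hfB' hε hεw.le (by linarith)
  have hobj' : lpObj gS gB fS fB z ≤
      lpObj gS gB fS fB (shiftMass w u ⟨b, j⟩ ⟨b, predIdx j⟩ ε) := by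
    refine hobj.trans ?_
    unfold lpObj
    rw [sum_mul_shiftMass fun e : SUnit gS × BUnit gB => fB e.2.1 e.2.2 - fS e.1.1 e.1.2]
    have := mul_nonneg hε.le (sub_nonneg.2 hfB')
    dsimp only
    linarith
  have hle : ∑ e : SUnit gS × BUnit gB, ((e.2.2 : ℕ) : ℝ) * w e ≤
      ∑ e : SUnit gS × BUnit gB,
        ((e.2.2 : ℕ) : ℝ) * shiftMass w u ⟨b, j⟩ ⟨b, predIdx j⟩ ε e :=
    hmin ⟨hfeas, hobj'⟩
  rw [sum_mul_shiftMass fun e : SUnit gS × BUnit gB => ((e.2.2 : ℕ) : ℝ)] at hle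
  have hpred : ((predIdx j : ℕ) : ℝ) = (j : ℕ) - 1 := by
    simp [predIdx, Nat.cast_sub (Nat.one_le_iff_ne_zero.2 hj)]
  simp only [hpred] at hle
  linarith

end Market
end
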